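/- The function h(u) = u · (1 + √(−2 log u)) is concave on the interval (0, 1]. -/

import Mathlib

theorem h_hasDeriv (u : ℝ) (h0 : 0 < u) (h1 : u < 1) :
    HasDerivAt (fun u : ℝ => u * (1 + Real.sqrt (-2 * Real.log u)))
      (1 + Real.sqrt (-2 * Real.log u) - 1 / Real.sqrt (-2 * Real.log u)) u := by
  have hl : 0 < -2 * Real.log u := by
    have := Real.log_neg h0 h1
    linarith
  have hs := Real.sqrt_pos.2 hl
  have hd := (hasDerivAt_id u).mul
    ((((Real.hasDerivAt_log h0.ne').const_mul (-2)).sqrt hl.ne').const_add 1)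
  refine hd.congr_deriv ?_
  simp only [id]
  field_simp
  ring

/-- The function `h(u) = u(1 + √(-2 log u))` is concave on `(0, 1]`. -/
theorem stmt13 :
    ConcaveOn ℝ (Set.Ioc (0 : ℝ) 1)
      (fun u => u * (1 + Real.sqrt (-2 * Real.log u))) := by
  apply AntitoneOn.concaveOn_of_deriv (convex_Ioc 0 1)
  · refine continuousOn_id.mul (continuousOn_const.add (ContinuousOn.sqrt
      (continuousOn_const.mul (Real.continuousOn_log.mono ?_))))
    intro x hx
    exact hx.1.ne'
  · rw [interior_Ioc]
    intro u hu
    exact (h_hasDeriv u hu.1 hu.2).differentiableAt.differentiableWithinAt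
  · rw [interior_Ioc]
    intro u hu v hv huv
    rw [(h_hasDeriv u hu.1 hu.2).deriv, (h_hasDeriv v hv.1 hv.2).deriv]
    have hlv := Real.log_neg hv.1 hv.2
    have hluv := Real.log_le_log hu.1 huv
    have hs : 0 < Real.sqrt (-2 * Real.log v) := Real.sqrt_pos.2 (by linarith)
    have hle : Real.sqrt (-2 * Real.log v) ≤ Real.sqrt (-2 * Real.log u) :=
      Real.sqrt_le_sqrt (by linarith)
    have := one_div_le_one_div_of_le hs hle
    linarith
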